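/- Let f : ℝⁿ × ℝⁿ → ℝ be smooth (C^∞) and let s₁, s₂ : ℝⁿ × ℝⁿ → ℂ be smooth and compactly supported. Define the prequantum operator Q_f by (Q_f s)(x) = i·(Ds)_x(X_f(x)) + 2π f(x) s(x). Then Q_f is symmetric for the L² inner product with respect to Lebesgue measure: ∫ (Q_f s₁)(x) · conj(s₂(x)) dx = ∫ s₁(x) · conj((Q_f s₂)(x)) dx. -/

import Mathlib

open MeasureTheory

/-- The Hamiltonian vector field `X_f(q,p) = (∇_p f(q,p), −∇_q f(q,p))`. -/
noncomputable def hamiltonianVF {n : ℕ}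
    (f : EuclideanSpace ℝ (Fin n) × EuclideanSpace ℝ (Fin n) → ℝ)
    (x : EuclideanSpace ℝ (Fin n) × EuclideanSpace ℝ (Fin n)) :
    EuclideanSpace ℝ (Fin n) × EuclideanSpace ℝ (Fin n) :=
  (gradient (fun p => f (x.1, p)) x.2, -gradient (fun q => f (q, x.2)) x.1)

/-- The prequantum operator `(Q_f s)(x) = i·(Ds)_x(X_f(x)) + 2π f(x) s(x)`. -/
noncomputable def prequantumOp {n : ℕ}
    (f : EuclideanSpace ℝ (Fin n) × EuclideanSpace ℝ (Fin n) → ℝ)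
    (s : EuclideanSpace ℝ (Fin n) × EuclideanSpace ℝ (Fin n) → ℂ)
    (x : EuclideanSpace ℝ (Fin n) × EuclideanSpace ℝ (Fin n)) : ℂ :=
  Complex.I * fderiv ℝ s x (hamiltonianVF f x) + (2 * Real.pi * f x : ℝ) * s x

/-- Integration by parts twice: the bracket `D_u f D_v g` is symmetric under the integral. -/
lemma integral_fderiv_swap {E : Type*} [NormedAddCommGroup E] [NormedSpace ℝ E]
    [FiniteDimensional ℝ E] [MeasurableSpace E] [BorelSpace E]
    (μ : Measure E) [μ.IsAddHaarMeasure] (f : E → ℝ) (g : E → ℂ)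
    (hf : ContDiff ℝ (⊤ : ℕ∞) f) (hg : ContDiff ℝ (⊤ : ℕ∞) g) (hc : HasCompactSupport g)
    (u v : E) :
    Integrable (fun x => fderiv ℝ f x u • fderiv ℝ g x v) μ ∧
    ∫ x, fderiv ℝ f x u • fderiv ℝ g x v ∂μ = ∫ x, fderiv ℝ f x v • fderiv ℝ g x u ∂μ := by
  have hfd : ∀ w, ContDiff ℝ (⊤ : ℕ∞) (fun x => fderiv ℝ f x w) := fun w =>
    (hf.fderiv_right (m := (⊤ : ℕ∞)) (by simp)).clm_apply contDiff_const
  have hgd' : ContDiff ℝ (⊤ : ℕ∞) (fderiv ℝ g) := hg.fderiv_right (m := (⊤ : ℕ∞)) (by simp)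
  have hgd : ∀ w, ContDiff ℝ (⊤ : ℕ∞) (fun x => fderiv ℝ g x w) := fun w =>
    hgd'.clm_apply contDiff_const
  have hgc : ∀ w, HasCompactSupport (fun x => fderiv ℝ g x w) := fun w =>
    hc.fderiv_apply (𝕜 := ℝ) w
  have hgdd : ∀ w z, Continuous (fun x => fderiv ℝ (fun y => fderiv ℝ g y w) x z) := fun w z =>
    (((hgd w).fderiv_right (m := (⊤ : ℕ∞)) (by simp)).clm_apply contDiff_const).continuous
  have hgcc : ∀ w z, HasCompactSupport (fun x => fderiv ℝ (fun y => fderiv ℝ g y w) x z) :=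
    fun w z => (hgc w).fderiv_apply (𝕜 := ℝ) z
  have hint : ∀ w z, Integrable (fun x => fderiv ℝ f x w • fderiv ℝ g x z) μ := fun w z =>
    ((hfd w).continuous.smul (hgd z).continuous).integrable_of_hasCompactSupport
      ((hgc z).smul_left)
  have key : ∀ w z, ∫ x, f x • fderiv ℝ (fun y => fderiv ℝ g y z) x w ∂μ
      = - ∫ x, fderiv ℝ f x w • fderiv ℝ g x z ∂μ := fun w z => by
    apply integral_smul_fderiv_eq_neg_fderiv_smul_of_integrable
    · exact hint w z
    · exact (hf.continuous.smul (hgdd z w)).integrable_of_hasCompactSupport ((hgcc z w).smul_left)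
    · exact (hf.continuous.smul (hgd z).continuous).integrable_of_hasCompactSupport
        ((hgc z).smul_left)
    · exact fun x _ => hf.differentiable (by simp) x
    · exact fun x _ => (hgd z).differentiable (by simp) x
  refine ⟨hint u v, ?_⟩
  rw [← neg_inj, ← key, ← key]
  congr 1
  ext x
  congr 1
  have h2 : ∀ w z, fderiv ℝ (fun y => fderiv ℝ g y w) x z = fderiv ℝ (fderiv ℝ g) x z w := by
    intro w z
    rw [fderiv_clm_apply (hgd'.differentiable (by simp) x) (differentiableAt_const w)]
    simp
  have h2le : (2 : WithTop ℕ∞) ≤ ((⊤ : ℕ∞) : WithTop ℕ∞) := by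
    exact WithTop.coe_le_coe.2 (le_top : (2 : ℕ∞) ≤ ⊤)
  rw [h2, h2]
  exact (hg.contDiffAt.isSymmSndFDerivAt (by simpa using h2le)).eq u v

/-- Expansion of the derivative along the Hamiltonian vector field in coordinates. -/
lemma fderiv_hamiltonianVF {n : ℕ}
    (f : EuclideanSpace ℝ (Fin n) × EuclideanSpace ℝ (Fin n) → ℝ)
    (hf : ContDiff ℝ (⊤ : ℕ∞) f)
    (g : EuclideanSpace ℝ (Fin n) × EuclideanSpace ℝ (Fin n) → ℂ)
    (x : EuclideanSpace ℝ (Fin n) × EuclideanSpace ℝ (Fin n)) :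
    fderiv ℝ g x (hamiltonianVF f x) = ∑ i : Fin n,
      (fderiv ℝ f x (0, EuclideanSpace.single i 1) • fderiv ℝ g x (EuclideanSpace.single i 1, 0)
      - fderiv ℝ f x (EuclideanSpace.single i 1, 0) •
          fderiv ℝ g x (0, EuclideanSpace.single i 1)) := by
  have hd : DifferentiableAt ℝ f x := hf.differentiable (by simp) x
  have h1 : ∀ i, gradient (fun p => f (x.1, p)) x.2 i
      = fderiv ℝ f x (0, EuclideanSpace.single i 1) := by
    intro i
    have := HasFDerivAt.comp (g := f) (f := fun p => (x.1, p)) x.2 hd.hasFDerivAt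
      (hasFDerivAt_prodMk_right x.1 x.2)
    have e := this.fderiv
    have h3 : inner ℝ (gradient (fun p => f (x.1, p)) x.2) (EuclideanSpace.single i 1)
        = fderiv ℝ (fun p => f (x.1, p)) x.2 (EuclideanSpace.single i 1) := by
      simp [gradient]
    rw [EuclideanSpace.inner_single_right] at h3
    simp only [one_mul, conj_trivial] at h3
    rw [h3]
    change fderiv ℝ (f ∘ fun p => (x.1, p)) x.2 _ = _
    rw [e]; simp
  have h2 : ∀ i, gradient (fun q => f (q, x.2)) x.1 i
      = fderiv ℝ f x (EuclideanSpace.single i 1, 0) := by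
    intro i
    have := HasFDerivAt.comp (g := f) (f := fun q => (q, x.2)) x.1 hd.hasFDerivAt
      (hasFDerivAt_prodMk_left x.1 x.2)
    have e := this.fderiv
    have h3 : inner ℝ (gradient (fun q => f (q, x.2)) x.1) (EuclideanSpace.single i 1)
        = fderiv ℝ (fun q => f (q, x.2)) x.1 (EuclideanSpace.single i 1) := by
      simp [gradient]
    rw [EuclideanSpace.inner_single_right] at h3
    simp only [one_mul, conj_trivial] at h3
    rw [h3]
    change fderiv ℝ (f ∘ fun q => (q, x.2)) x.1 _ = _
    rw [e]; simp
  have hv : hamiltonianVF f x = ∑ i : Fin n,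
      (fderiv ℝ f x (0, EuclideanSpace.single i 1) •
        ((EuclideanSpace.single i 1, 0) : EuclideanSpace ℝ (Fin n) × EuclideanSpace ℝ (Fin n))
      - fderiv ℝ f x (EuclideanSpace.single i 1, 0) • (0, EuclideanSpace.single i 1)) := by
    simp only [← h1, ← h2]
    unfold hamiltonianVF
    ext j
    · simp [Prod.fst_sum, Pi.single_apply]
    · simp [Prod.snd_sum, Pi.single_apply]
  rw [hv, map_sum]
  simp only [map_sub, map_smul]

lemma integral_fderiv_hamiltonianVF {n : ℕ}
    (f : EuclideanSpace ℝ (Fin n) × EuclideanSpace ℝ (Fin n) → ℝ)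
    (hf : ContDiff ℝ (⊤ : ℕ∞) f)
    (g : EuclideanSpace ℝ (Fin n) × EuclideanSpace ℝ (Fin n) → ℂ)
    (hg : ContDiff ℝ (⊤ : ℕ∞) g) (hc : HasCompactSupport g) :
    Integrable (fun x => fderiv ℝ g x (hamiltonianVF f x)) ∧
    ∫ x, fderiv ℝ g x (hamiltonianVF f x) = 0 := by
  have : (volume : Measure (EuclideanSpace ℝ (Fin n) × EuclideanSpace ℝ (Fin n))).IsAddHaarMeasure
    := Measure.prod.instIsAddHaarMeasure _ _
  have H := integral_fderiv_swap
    (volume : Measure (EuclideanSpace ℝ (Fin n) × EuclideanSpace ℝ (Fin n))) f g hf hg hc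
  simp only [fderiv_hamiltonianVF f hf g]
  constructor
  · exact integrable_finsetSum _ fun i _ => (H _ _).1.sub (H _ _).1
  · rw [integral_finsetSum]
    swap
    · exact fun i _ => (H _ _).1.sub (H _ _).1
    refine Finset.sum_eq_zero fun i _ => ?_
    rw [integral_sub (H _ _).1 (H _ _).1, (H _ _).2, sub_self]

/-- The prequantum operator `Q_f` is symmetric for the `L²` inner product on
compactly supported smooth functions. -/
theorem prequantumOp_symmetric {n : ℕ}
    (f : EuclideanSpace ℝ (Fin n) × EuclideanSpace ℝ (Fin n) → ℝ)
    (hf : ContDiff ℝ (⊤ : ℕ∞) f)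
    (s₁ s₂ : EuclideanSpace ℝ (Fin n) × EuclideanSpace ℝ (Fin n) → ℂ)
    (hs₁ : ContDiff ℝ (⊤ : ℕ∞) s₁) (hs₂ : ContDiff ℝ (⊤ : ℕ∞) s₂)
    (hc₁ : HasCompactSupport s₁) (hc₂ : HasCompactSupport s₂) :
    ∫ x, prequantumOp f s₁ x * (starRingEnd ℂ) (s₂ x)
      = ∫ x, s₁ x * (starRingEnd ℂ) (prequantumOp f s₂ x) := by
  have : (volume : Measure (EuclideanSpace ℝ (Fin n) × EuclideanSpace ℝ (Fin n))).IsAddHaarMeasure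
    := Measure.prod.instIsAddHaarMeasure _ _
  have hcs : ContDiff ℝ (⊤ : ℕ∞) (fun x => (starRingEnd ℂ) (s₂ x)) :=
    Complex.conjCLE.contDiff.comp hs₂
  have hg : ContDiff ℝ (⊤ : ℕ∞) (fun x => s₁ x * (starRingEnd ℂ) (s₂ x)) := hs₁.mul hcs
  have hgc : HasCompactSupport (fun x => s₁ x * (starRingEnd ℂ) (s₂ x)) := hc₁.mul_right
  obtain ⟨hi, h0⟩ := integral_fderiv_hamiltonianVF f hf _ hg hgc
  have hD : ∀ x w, fderiv ℝ (fun x => s₁ x * (starRingEnd ℂ) (s₂ x)) x w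
      = s₁ x * (starRingEnd ℂ) (fderiv ℝ s₂ x w)
        + fderiv ℝ s₁ x w * (starRingEnd ℂ) (s₂ x) := by
    intro x w
    have d1 := (hs₁.differentiable (by simp) x).hasFDerivAt
    have d2 := (hs₂.differentiable (by simp) x).hasFDerivAt
    have d3 : HasFDerivAt (fun x => (starRingEnd ℂ) (s₂ x)) _ x :=
      (Complex.conjCLE.toContinuousLinearMap.hasFDerivAt).comp x d2
    have d4 : HasFDerivAt (fun x => s₁ x * (starRingEnd ℂ) (s₂ x)) _ x := d1.mul d3
    rw [d4.fderiv]
    simp [mul_comm]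
  have hpt : ∀ x, prequantumOp f s₁ x * (starRingEnd ℂ) (s₂ x)
      = s₁ x * (starRingEnd ℂ) (prequantumOp f s₂ x) + Complex.I *
        fderiv ℝ (fun x => s₁ x * (starRingEnd ℂ) (s₂ x)) x (hamiltonianVF f x) := by
    intro x
    rw [hD]
    simp only [prequantumOp, map_add, map_mul, Complex.conj_I, Complex.conj_ofReal]
    ring
  by_cases hint : Integrable (fun x => s₁ x * (starRingEnd ℂ) (prequantumOp f s₂ x))
  · simp only [hpt]
    rw [integral_add hint (hi.const_mul _), integral_const_mul, h0]
    simp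
  · rw [integral_undef hint, integral_undef]
    intro h
    apply hint
    refine (h.sub (hi.const_mul Complex.I)).congr (Filter.Eventually.of_forall fun x => ?_)
    simp [hpt x]
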